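/- arXiv:2511.07942 — 2 statements merged into one kernel-verified Lean document; each statement's English description precedes it below -/
import Mathlib

section
/- Let S and A be finite nonempty sets, let π be a policy, let T and T⁰ be transition kernels, let γ ∈ (0,1) be a discount factor, and let μ be an initial distribution on S. If D_TV(T(·|s,a), T⁰(·|s,a)) ≤ ρ' for every pair (s,a) ∈ S × A, then the discounted state–action occupancy measures satisfy D_TV(d^π_T(·,·), d^π_{T⁰}(·,·)) ≤ γρ'/(1−γ), where d^π_T(s,a) = π(a|s) d^π_T(s). -/
open Matrix

/-- Total variation distance between two (finitely supported) distributions: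
`D_TV(p,q) = (1/2) ∑ₓ |p x − q x|`. -/
noncomputable def tvDist {X : Type*} [Fintype X] (p q : X → ℝ) : ℝ :=
  (1 / 2) * ∑ x, |p x - q x|

/-- The state-transition matrix `P(s,s') = ∑ₐ π(a|s) T(s'|s,a)` induced by a
policy `π` and a transition kernel `T`. -/
noncomputable def policyMatrix {S A : Type*} [Fintype S] [Fintype A]
    (π : S → A → ℝ) (T : S → A → S → ℝ) : Matrix S S ℝ :=
  Matrix.of fun s s' => ∑ a, π s a * T s a s'

/-- The discounted state occupancy measure
`d^π_T(s) = (1−γ) ∑_{t≥0} γ^t (μᵀ Pᵗ)(s)`. -/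
noncomputable def stateOcc {S A : Type*} [Fintype S] [DecidableEq S] [Fintype A]
    (π : S → A → ℝ) (T : S → A → S → ℝ) (γ : ℝ) (μ : S → ℝ) (s : S) : ℝ :=
  (1 - γ) * ∑' t : ℕ, γ ^ t * Matrix.vecMul μ (policyMatrix π T ^ t) s


/-- The discounted state–action occupancy measure `d^π_T(s,a) = π(a|s) d^π_T(s)`. -/
noncomputable def saOcc {S A : Type*} [Fintype S] [DecidableEq S] [Fintype A]
    (π : S → A → ℝ) (T : S → A → S → ℝ) (γ : ℝ) (μ : S → ℝ) (p : S × A) : ℝ :=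
  π p.1 p.2 * stateOcc π T γ μ p.1

theorem sum_abs_vecMul_le {S : Type*} [Fintype S] (v : S → ℝ) (M : Matrix S S ℝ) (c : ℝ)
    (hM : ∀ s, ∑ s', |M s s'| ≤ c) : ∑ s', |(v ᵥ* M) s'| ≤ c * ∑ s, |v s| := by
  calc ∑ s', |(v ᵥ* M) s'| ≤ ∑ s', ∑ s, |v s| * |M s s'| := by
        refine Finset.sum_le_sum fun s' _ => ?_
        simp only [Matrix.vecMul, dotProduct, ← abs_mul]
        exact Finset.abs_sum_le_sum_abs _ _
    _ = ∑ s, |v s| * ∑ s', |M s s'| := by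
        rw [Finset.sum_comm]
        simp only [Finset.mul_sum]
    _ ≤ ∑ s, |v s| * c :=
        Finset.sum_le_sum fun s _ => mul_le_mul_of_nonneg_left (hM s) (abs_nonneg _)
    _ = c * ∑ s, |v s| := by rw [← Finset.sum_mul, mul_comm]

theorem sum_abs_vecMul_pow_le {S : Type*} [Fintype S] [DecidableEq S] (v : S → ℝ)
    (M : Matrix S S ℝ) (hM : ∀ s, ∑ s', |M s s'| ≤ 1) (t : ℕ) :
    ∑ s, |(v ᵥ* M ^ t) s| ≤ ∑ s, |v s| := by
  induction t with
  | zero => simp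
  | succ t ih =>
    rw [pow_succ, ← Matrix.vecMul_vecMul]
    have h := sum_abs_vecMul_le (v ᵥ* M ^ t) M 1 hM
    linarith

theorem summable_discounted_vecMul_pow {S : Type*} [Fintype S] [DecidableEq S] (v : S → ℝ)
    (M : Matrix S S ℝ) (hM : ∀ s, ∑ s', |M s s'| ≤ 1) {γ : ℝ} (hγ0 : 0 ≤ γ) (hγ1 : γ < 1)
    (s : S) : Summable fun t : ℕ => γ ^ t * (v ᵥ* M ^ t) s := by
  refine Summable.of_norm_bounded
    ((summable_geometric_of_lt_one hγ0 hγ1).mul_right (∑ s, |v s|)) fun t => ?_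
  rw [Real.norm_eq_abs, abs_mul, abs_of_nonneg (pow_nonneg hγ0 t)]
  refine mul_le_mul_of_nonneg_left ?_ (pow_nonneg hγ0 t)
  exact (Finset.single_le_sum (f := fun s => |(v ᵥ* M ^ t) s|) (fun _ _ => abs_nonneg _)
    (Finset.mem_univ s)).trans (sum_abs_vecMul_pow_le v M hM t)

theorem sum_abs_policyMatrix_le {S A : Type*} [Fintype S] [Fintype A]
    (π : S → A → ℝ) (hπ_nonneg : ∀ s a, 0 ≤ π s a) (hπ_sum : ∀ s, ∑ a, π s a = 1)
    (T : S → A → S → ℝ) (c : ℝ) (hT : ∀ s a, ∑ s', |T s a s'| ≤ c) (s : S) :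
    ∑ s', |policyMatrix π T s s'| ≤ c := by
  calc ∑ s', |policyMatrix π T s s'| ≤ ∑ s', ∑ a, π s a * |T s a s'| := by
        refine Finset.sum_le_sum fun s' _ => ?_
        simp only [policyMatrix, Matrix.of_apply]
        refine (Finset.abs_sum_le_sum_abs _ _).trans_eq ?_
        simp only [abs_mul, abs_of_nonneg (hπ_nonneg _ _)]
    _ = ∑ a, π s a * ∑ s', |T s a s'| := by
        rw [Finset.sum_comm]
        simp only [Finset.mul_sum]
    _ ≤ ∑ a, π s a * c :=
        Finset.sum_le_sum fun a _ => mul_le_mul_of_nonneg_left (hT s a) (hπ_nonneg s a)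
    _ = c := by rw [← Finset.sum_mul, hπ_sum, one_mul]

theorem policyMatrix_sub {S A : Type*} [Fintype S] [Fintype A]
    (π : S → A → ℝ) (T T0 : S → A → S → ℝ) :
    policyMatrix π T - policyMatrix π T0 = policyMatrix π (T - T0) := by
  ext s s'
  simp [policyMatrix, mul_sub]

/-- The Bellman flow equation `d = (1 - γ) μ + γ d P`. -/
theorem stateOcc_eq_add_vecMul {S A : Type*} [Fintype S] [DecidableEq S] [Fintype A]
    (π : S → A → ℝ) (T : S → A → S → ℝ) {γ : ℝ} (μ : S → ℝ)
    (hP : ∀ s, ∑ s', |policyMatrix π T s s'| ≤ 1) (hγ0 : 0 ≤ γ) (hγ1 : γ < 1) :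
    stateOcc π T γ μ = (1 - γ) • μ + γ • (stateOcc π T γ μ ᵥ* policyMatrix π T) := by
  have hsum := summable_discounted_vecMul_pow μ (policyMatrix π T) hP hγ0 hγ1
  ext s
  have hstep : ∑' t : ℕ, γ ^ (t + 1) * (μ ᵥ* policyMatrix π T ^ (t + 1)) s =
      γ * ∑ s', (∑' t : ℕ, γ ^ t * (μ ᵥ* policyMatrix π T ^ t) s') * policyMatrix π T s' s := by
    simp only [← tsum_mul_right]
    rw [← Summable.tsum_finsetSum fun s' _ => (hsum s').mul_right _, ← tsum_mul_left]
    refine tsum_congr fun t => ?_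
    rw [pow_succ (policyMatrix π T), ← Matrix.vecMul_vecMul]
    change γ ^ (t + 1) * ∑ s', (μ ᵥ* policyMatrix π T ^ t) s' * policyMatrix π T s' s = _
    rw [Finset.mul_sum, Finset.mul_sum]
    exact Finset.sum_congr rfl fun s' _ => by ring
  have hocc : (stateOcc π T γ μ ᵥ* policyMatrix π T) s = (1 - γ) *
      ∑ s', (∑' t : ℕ, γ ^ t * (μ ᵥ* policyMatrix π T ^ t) s') * policyMatrix π T s' s := by
    rw [Matrix.vecMul, dotProduct, Finset.mul_sum]
    exact Finset.sum_congr rfl fun s' _ => by rw [stateOcc, mul_assoc]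
  rw [Pi.add_apply, Pi.smul_apply, Pi.smul_apply, smul_eq_mul, smul_eq_mul, hocc, stateOcc,
    (hsum s).tsum_eq_zero_add, hstep]
  simp only [pow_zero, Matrix.vecMul_one, one_mul]
  ring

theorem sum_abs_stateOcc_le {S A : Type*} [Fintype S] [DecidableEq S] [Fintype A]
    (π : S → A → ℝ) (T : S → A → S → ℝ) {γ : ℝ} (μ : S → ℝ)
    (hP : ∀ s, ∑ s', |policyMatrix π T s s'| ≤ 1) (hγ0 : 0 ≤ γ) (hγ1 : γ < 1) :
    ∑ s, |stateOcc π T γ μ s| ≤ ∑ s, |μ s| := by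
  have hstep := sum_abs_vecMul_le (stateOcc π T γ μ) _ 1 hP
  have hle : ∑ s, |stateOcc π T γ μ s| ≤ (1 - γ) * ∑ s, |μ s| +
      γ * ∑ s, |(stateOcc π T γ μ ᵥ* policyMatrix π T) s| := by
    rw [Finset.mul_sum, Finset.mul_sum, ← Finset.sum_add_distrib]
    refine Finset.sum_le_sum fun s _ => ?_
    conv_lhs => rw [stateOcc_eq_add_vecMul π T μ hP hγ0 hγ1]
    refine (abs_add_le _ _).trans_eq ?_
    simp [abs_mul, abs_of_nonneg hγ0, abs_of_nonneg (sub_nonneg.2 hγ1.le)]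
  nlinarith [mul_le_mul_of_nonneg_left hstep hγ0]

theorem tvDist_saOcc {S A : Type*} [Fintype S] [DecidableEq S] [Fintype A]
    (π : S → A → ℝ) (hπ_nonneg : ∀ s a, 0 ≤ π s a) (hπ_sum : ∀ s, ∑ a, π s a = 1)
    (T T0 : S → A → S → ℝ) (γ : ℝ) (μ : S → ℝ) :
    tvDist (saOcc π T γ μ) (saOcc π T0 γ μ) = tvDist (stateOcc π T γ μ) (stateOcc π T0 γ μ) := by
  simp only [tvDist, saOcc, Fintype.sum_prod_type, ← mul_sub, abs_mul,
    abs_of_nonneg (hπ_nonneg _ _), ← Finset.sum_mul, hπ_sum, one_mul]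

theorem state_action_occupancy_tv_bound
    {S A : Type*} [Fintype S] [DecidableEq S] [Fintype A] [Nonempty S] [Nonempty A]
    (π : S → A → ℝ) (hπ_nonneg : ∀ s a, 0 ≤ π s a)
    (hπ_sum : ∀ s, ∑ a, π s a = 1)
    (T T0 : S → A → S → ℝ)
    (hT_nonneg : ∀ s a s', 0 ≤ T s a s') (hT_sum : ∀ s a, ∑ s', T s a s' = 1)
    (hT0_nonneg : ∀ s a s', 0 ≤ T0 s a s') (hT0_sum : ∀ s a, ∑ s', T0 s a s' = 1)
    (γ : ℝ) (hγ0 : 0 < γ) (hγ1 : γ < 1)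
    (μ : S → ℝ) (hμ_nonneg : ∀ s, 0 ≤ μ s) (hμ_sum : ∑ s, μ s = 1)
    (ρ' : ℝ) (hρ : ∀ s a, tvDist (T s a) (T0 s a) ≤ ρ') :
    tvDist (saOcc π T γ μ) (saOcc π T0 γ μ) ≤ γ * ρ' / (1 - γ) := by
  have hP : ∀ s, ∑ s', |policyMatrix π T s s'| ≤ 1 :=
    sum_abs_policyMatrix_le π hπ_nonneg hπ_sum T 1 fun s a => by
      simp only [abs_of_nonneg (hT_nonneg _ _ _), hT_sum, le_refl]
  have hP0 : ∀ s, ∑ s', |policyMatrix π T0 s s'| ≤ 1 :=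
    sum_abs_policyMatrix_le π hπ_nonneg hπ_sum T0 1 fun s a => by
      simp only [abs_of_nonneg (hT0_nonneg _ _ _), hT0_sum, le_refl]
  have hsub : ∀ s, ∑ s', |(policyMatrix π T - policyMatrix π T0) s s'| ≤ 2 * ρ' := by
    rw [policyMatrix_sub]
    refine sum_abs_policyMatrix_le π hπ_nonneg hπ_sum _ _ fun s a => ?_
    have h := hρ s a
    simp only [tvDist] at h
    simp only [Pi.sub_apply]
    linarith
  rw [tvDist_saOcc π hπ_nonneg hπ_sum, tvDist]
  set d := stateOcc π T γ μ with hd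
  set d0 := stateOcc π T0 γ μ with hd0
  have hflow : d - d0 = γ • ((d - d0) ᵥ* policyMatrix π T0) +
      γ • (d ᵥ* (policyMatrix π T - policyMatrix π T0)) := by
    have h := stateOcc_eq_add_vecMul π T μ hP hγ0.le hγ1
    have h0 := stateOcc_eq_add_vecMul π T0 μ hP0 hγ0.le hγ1
    rw [← hd] at h
    rw [← hd0] at h0
    rw [Matrix.sub_vecMul, Matrix.vecMul_sub]
    conv_lhs => rw [h, h0]
    module
  have hle : ∑ s, |d s - d0 s| ≤ γ * ∑ s, |((d - d0) ᵥ* policyMatrix π T0) s| +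
      γ * ∑ s, |(d ᵥ* (policyMatrix π T - policyMatrix π T0)) s| := by
    rw [Finset.mul_sum, Finset.mul_sum, ← Finset.sum_add_distrib]
    refine Finset.sum_le_sum fun s _ => ?_
    have h := congrFun hflow s
    rw [Pi.sub_apply] at h
    rw [h]
    refine (abs_add_le _ _).trans_eq ?_
    simp only [Pi.smul_apply, smul_eq_mul, abs_mul, abs_of_pos hγ0]
  have hd_le : ∑ s, |d s| ≤ 1 := by
    refine (sum_abs_stateOcc_le π T μ hP hγ0.le hγ1).trans_eq ?_
    simp only [abs_of_nonneg (hμ_nonneg _), hμ_sum]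
  have hρ_nonneg : 0 ≤ 2 * ρ' :=
    (Finset.sum_nonneg fun _ _ => abs_nonneg _).trans (hsub (Classical.arbitrary S))
  have h1 := mul_le_mul_of_nonneg_left (sum_abs_vecMul_le (d - d0) _ 1 hP0) hγ0.le
  have h2 := mul_le_mul_of_nonneg_left ((sum_abs_vecMul_le d _ _ hsub).trans
    (mul_le_mul_of_nonneg_left hd_le hρ_nonneg)) hγ0.le
  simp only [Pi.sub_apply (f := d)] at h1
  rw [le_div_iff₀ (sub_pos.2 hγ1)]
  linarith
end

section
/- Let S and A be finite nonempty sets, let π be a policy, let T and T⁰ be transition kernels, let γ ∈ (0,1) be a discount factor, and let μ be an initial distribution on S. If D_TV(T(·|s,a), T⁰(·|s,a)) ≤ ρ' for every pair (s,a) ∈ S × A, then the discounted triplet occupancy measures satisfy D_TV(d^π_T(·,·,·), d^π_{T⁰}(·,·,·)) ≤ ρ'/(1−γ), where d^π_T(s,a,s') = π(a|s) d^π_T(s) T(s'|s,a). -/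
open Matrix

/-- The discounted triplet occupancy measure
`d^π_T(s,a,s') = π(a|s) d^π_T(s) T(s'|s,a)`. -/
noncomputable def tripletOcc {S A : Type*} [Fintype S] [DecidableEq S] [Fintype A]
    (π : S → A → ℝ) (T : S → A → S → ℝ) (γ : ℝ) (μ : S → ℝ)
    (x : S × A × S) : ℝ :=
  π x.1 x.2.1 * stateOcc π T γ μ x.1 * T x.1 x.2.1 x.2.2

theorem vecMul_pow_policyMatrix_succ {S A : Type*} [Fintype S] [DecidableEq S] [Fintype A]
    (π : S → A → ℝ) (T : S → A → S → ℝ) (μ : S → ℝ) (t : ℕ) (s' : S) :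
    Matrix.vecMul μ (policyMatrix π T ^ (t + 1)) s' =
      ∑ s, ∑ a, π s a * T s a s' * Matrix.vecMul μ (policyMatrix π T ^ t) s := by
  rw [pow_succ, ← Matrix.vecMul_vecMul]
  simp only [Matrix.vecMul, dotProduct, policyMatrix, Matrix.of_apply]
  refine Finset.sum_congr rfl fun s _ => ?_
  rw [mul_comm, Finset.sum_mul]

theorem vecMul_pow_policyMatrix_nonneg {S A : Type*} [Fintype S] [DecidableEq S] [Fintype A]
    {π : S → A → ℝ} (hπ : ∀ s a, 0 ≤ π s a) {T : S → A → S → ℝ} (hT : ∀ s a s', 0 ≤ T s a s')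
    {μ : S → ℝ} (hμ : ∀ s, 0 ≤ μ s) (t : ℕ) (s : S) :
    0 ≤ Matrix.vecMul μ (policyMatrix π T ^ t) s := by
  induction t generalizing s with
  | zero => simpa using hμ s
  | succ t ih =>
    rw [vecMul_pow_policyMatrix_succ]
    exact Finset.sum_nonneg fun r _ => Finset.sum_nonneg fun a _ =>
      mul_nonneg (mul_nonneg (hπ r a) (hT r a s)) (ih r)

/-- Summing `π(a|s) T(s'|s,a) v(s)` over all triplets gives the total mass of `v`. -/
theorem sum_policy_mul_kernel_mul {S A : Type*} [Fintype S] [Fintype A]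
    {π : S → A → ℝ} (hπ : ∀ s, ∑ a, π s a = 1) {T : S → A → S → ℝ}
    (hT : ∀ s a, ∑ s', T s a s' = 1) (v : S → ℝ) :
    ∑ s', ∑ s, ∑ a, π s a * T s a s' * v s = ∑ s, v s := by
  rw [Finset.sum_comm]
  refine Finset.sum_congr rfl fun s _ => ?_
  rw [Finset.sum_comm]
  simp only [← Finset.sum_mul, ← Finset.mul_sum, hT, mul_one, hπ, one_mul]

theorem sum_vecMul_pow_policyMatrix {S A : Type*} [Fintype S] [DecidableEq S] [Fintype A]
    {π : S → A → ℝ} (hπ : ∀ s, ∑ a, π s a = 1) {T : S → A → S → ℝ}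
    (hT : ∀ s a, ∑ s', T s a s' = 1) (μ : S → ℝ) (t : ℕ) :
    ∑ s, Matrix.vecMul μ (policyMatrix π T ^ t) s = ∑ s, μ s := by
  induction t with
  | zero => simp
  | succ t ih =>
    simp only [vecMul_pow_policyMatrix_succ]
    rw [sum_policy_mul_kernel_mul hπ hT, ih]

theorem summable_discounted_vecMul_pow_s3 {S A : Type*} [Fintype S] [DecidableEq S] [Fintype A]
    {π : S → A → ℝ} (hπ0 : ∀ s a, 0 ≤ π s a) (hπ : ∀ s, ∑ a, π s a = 1)
    {T : S → A → S → ℝ} (hT0 : ∀ s a s', 0 ≤ T s a s') (hT : ∀ s a, ∑ s', T s a s' = 1)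
    {γ : ℝ} (hγ0 : 0 ≤ γ) (hγ1 : γ < 1) {μ : S → ℝ} (hμ : ∀ s, 0 ≤ μ s) (s : S) :
    Summable fun t : ℕ => γ ^ t * Matrix.vecMul μ (policyMatrix π T ^ t) s := by
  refine Summable.of_nonneg_of_le
    (fun t => mul_nonneg (pow_nonneg hγ0 t) (vecMul_pow_policyMatrix_nonneg hπ0 hT0 hμ t s))
    (fun t => mul_le_mul_of_nonneg_left ?_ (pow_nonneg hγ0 t))
    ((summable_geometric_of_lt_one hγ0 hγ1).mul_right (∑ s, μ s))
  rw [← sum_vecMul_pow_policyMatrix hπ hT μ t]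
  exact Finset.single_le_sum
    (fun r _ => vecMul_pow_policyMatrix_nonneg hπ0 hT0 hμ t r) (Finset.mem_univ s)

theorem stateOcc_nonneg {S A : Type*} [Fintype S] [DecidableEq S] [Fintype A]
    {π : S → A → ℝ} (hπ0 : ∀ s a, 0 ≤ π s a) {T : S → A → S → ℝ} (hT0 : ∀ s a s', 0 ≤ T s a s')
    {γ : ℝ} (hγ0 : 0 ≤ γ) (hγ1 : γ ≤ 1) {μ : S → ℝ} (hμ : ∀ s, 0 ≤ μ s) (s : S) :
    0 ≤ stateOcc π T γ μ s :=
  mul_nonneg (sub_nonneg.2 hγ1) <| tsum_nonneg fun t =>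
    mul_nonneg (pow_nonneg hγ0 t) (vecMul_pow_policyMatrix_nonneg hπ0 hT0 hμ t s)

/-- The Bellman flow equation for the discounted state occupancy measure. -/
theorem stateOcc_flow {S A : Type*} [Fintype S] [DecidableEq S] [Fintype A]
    {π : S → A → ℝ} (hπ0 : ∀ s a, 0 ≤ π s a) (hπ : ∀ s, ∑ a, π s a = 1)
    {T : S → A → S → ℝ} (hT0 : ∀ s a s', 0 ≤ T s a s') (hT : ∀ s a, ∑ s', T s a s' = 1)
    {γ : ℝ} (hγ0 : 0 ≤ γ) (hγ1 : γ < 1) {μ : S → ℝ} (hμ : ∀ s, 0 ≤ μ s) (s' : S) :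
    stateOcc π T γ μ s' =
      (1 - γ) * μ s' + γ * ∑ s, ∑ a, π s a * T s a s' * stateOcc π T γ μ s := by
  have hsum := summable_discounted_vecMul_pow_s3 hπ0 hπ hT0 hT hγ0 hγ1 hμ
  have key : ∑' t : ℕ, γ ^ (t + 1) * Matrix.vecMul μ (policyMatrix π T ^ (t + 1)) s' =
      γ * ∑ s, ∑ a, π s a * T s a s' *
        ∑' t : ℕ, γ ^ t * Matrix.vecMul μ (policyMatrix π T ^ t) s := by
    simp only [← tsum_mul_left]
    rw [Finset.sum_congr rfl fun s _ =>
        (Summable.tsum_finsetSum fun a _ => (hsum s).mul_left (π s a * T s a s')).symm,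
      ← Summable.tsum_finsetSum fun s _ =>
        summable_sum fun a _ => (hsum s).mul_left (π s a * T s a s'),
      ← tsum_mul_left]
    refine tsum_congr fun t => ?_
    rw [vecMul_pow_policyMatrix_succ]
    simp only [Finset.mul_sum]
    refine Finset.sum_congr rfl fun s _ => Finset.sum_congr rfl fun a _ => ?_
    ring
  unfold stateOcc
  rw [(hsum s').tsum_eq_zero_add, key, mul_add]
  simp only [pow_zero, Matrix.vecMul_one, one_mul, Finset.mul_sum]
  congr 1
  refine Finset.sum_congr rfl fun s _ => Finset.sum_congr rfl fun a _ => ?_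
  ring

theorem sum_stateOcc {S A : Type*} [Fintype S] [DecidableEq S] [Fintype A]
    {π : S → A → ℝ} (hπ0 : ∀ s a, 0 ≤ π s a) (hπ : ∀ s, ∑ a, π s a = 1)
    {T : S → A → S → ℝ} (hT0 : ∀ s a s', 0 ≤ T s a s') (hT : ∀ s a, ∑ s', T s a s' = 1)
    {γ : ℝ} (hγ0 : 0 ≤ γ) (hγ1 : γ < 1) {μ : S → ℝ} (hμ : ∀ s, 0 ≤ μ s) :
    ∑ s, stateOcc π T γ μ s = ∑ s, μ s := by
  have h := Finset.sum_congr rfl fun s (_ : s ∈ Finset.univ) =>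
    stateOcc_flow hπ0 hπ hT0 hT hγ0 hγ1 hμ s
  rw [Finset.sum_add_distrib, ← Finset.mul_sum, ← Finset.mul_sum,
    sum_policy_mul_kernel_mul hπ hT] at h
  have hpos : 0 < 1 - γ := sub_pos.2 hγ1
  refine mul_left_cancel₀ hpos.ne' ?_
  linarith

theorem triplet_occupancy_tv_bound
    {S A : Type*} [Fintype S] [DecidableEq S] [Fintype A] [Nonempty S] [Nonempty A]
    (π : S → A → ℝ) (hπ_nonneg : ∀ s a, 0 ≤ π s a)
    (hπ_sum : ∀ s, ∑ a, π s a = 1)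
    (T T0 : S → A → S → ℝ)
    (hT_nonneg : ∀ s a s', 0 ≤ T s a s') (hT_sum : ∀ s a, ∑ s', T s a s' = 1)
    (hT0_nonneg : ∀ s a s', 0 ≤ T0 s a s') (hT0_sum : ∀ s a, ∑ s', T0 s a s' = 1)
    (γ : ℝ) (hγ0 : 0 < γ) (hγ1 : γ < 1)
    (μ : S → ℝ) (hμ_nonneg : ∀ s, 0 ≤ μ s) (hμ_sum : ∑ s, μ s = 1)
    (ρ' : ℝ) (hρ : ∀ s a, tvDist (T s a) (T0 s a) ≤ ρ') :
    tvDist (tripletOcc π T γ μ) (tripletOcc π T0 γ μ) ≤ ρ' / (1 - γ) := by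
  set d := stateOcc π T γ μ with hd
  set e := stateOcc π T0 γ μ with he
  have he0 : ∀ s, 0 ≤ e s := stateOcc_nonneg hπ_nonneg hT0_nonneg hγ0.le hγ1.le hμ_nonneg
  have he1 : ∑ s, e s = 1 :=
    (sum_stateOcc hπ_nonneg hπ_sum hT0_nonneg hT0_sum hγ0.le hγ1 hμ_nonneg).trans hμ_sum
  set W : ℝ := ∑ s, ∑ a, ∑ s', |π s a * d s * T s a s' - π s a * e s * T0 s a s'| with hW
  have hstate : ∑ s, |d s - e s| ≤ γ * W := by
    have hcomm : W = ∑ s', ∑ s, ∑ a, |π s a * d s * T s a s' - π s a * e s * T0 s a s'| := by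
      rw [hW, Finset.sum_comm (s := (Finset.univ : Finset S)) (t := (Finset.univ : Finset S))]
      exact Finset.sum_congr rfl fun s _ => Finset.sum_comm
    rw [hcomm, Finset.mul_sum]
    refine Finset.sum_le_sum fun s' _ => ?_
    have hflow : d s' - e s' =
        γ * ∑ s, ∑ a, (π s a * d s * T s a s' - π s a * e s * T0 s a s') := by
      rw [hd, stateOcc_flow hπ_nonneg hπ_sum hT_nonneg hT_sum hγ0.le hγ1 hμ_nonneg,
        he, stateOcc_flow hπ_nonneg hπ_sum hT0_nonneg hT0_sum hγ0.le hγ1 hμ_nonneg,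
        add_sub_add_left_eq_sub, ← mul_sub]
      simp only [Finset.sum_sub_distrib, mul_right_comm]
    rw [hflow, abs_mul, abs_of_pos hγ0]
    refine mul_le_mul_of_nonneg_left ?_ hγ0.le
    exact (Finset.abs_sum_le_sum_abs _ _).trans
      (Finset.sum_le_sum fun s _ => Finset.abs_sum_le_sum_abs _ _)
  have htriplet : W ≤ ∑ s, |d s - e s| + 2 * ρ' := by
    calc W ≤ ∑ s, ∑ a, π s a * (|d s - e s| + e s * (2 * ρ')) := by
          refine Finset.sum_le_sum fun s _ => Finset.sum_le_sum fun a _ => ?_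
          have hTV : ∑ s', |T s a s' - T0 s a s'| ≤ 2 * ρ' := by
            have := hρ s a
            unfold tvDist at this
            linarith
          calc ∑ s', |π s a * d s * T s a s' - π s a * e s * T0 s a s'|
              ≤ ∑ s', π s a * (|d s - e s| * T s a s' + e s * |T s a s' - T0 s a s'|) := by
                refine Finset.sum_le_sum fun s' _ => ?_
                rw [show π s a * d s * T s a s' - π s a * e s * T0 s a s' =
                  π s a * ((d s - e s) * T s a s' + e s * (T s a s' - T0 s a s')) by ring,
                  abs_mul, abs_of_nonneg (hπ_nonneg s a)]
                refine mul_le_mul_of_nonneg_left ((abs_add_le _ _).trans_eq ?_) (hπ_nonneg s a)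
                rw [abs_mul, abs_mul, abs_of_nonneg (hT_nonneg s a s'), abs_of_nonneg (he0 s)]
            _ = π s a * (|d s - e s| + e s * ∑ s', |T s a s' - T0 s a s'|) := by
                rw [← Finset.mul_sum, Finset.sum_add_distrib, ← Finset.mul_sum,
                  ← Finset.mul_sum, hT_sum, mul_one]
            _ ≤ π s a * (|d s - e s| + e s * (2 * ρ')) := by
                gcongr
                · exact hπ_nonneg s a
                · exact he0 s
      _ = ∑ s, |d s - e s| + 2 * ρ' := by
          simp only [← Finset.sum_mul, hπ_sum, one_mul, Finset.sum_add_distrib, he1]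
  have hTV : tvDist (tripletOcc π T γ μ) (tripletOcc π T0 γ μ) = 1 / 2 * W := by
    simp only [tvDist, tripletOcc, Fintype.sum_prod_type, hW, hd, he]
  rw [hTV, le_div_iff₀ (sub_pos.2 hγ1)]
  linarith
end
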